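/- Every two-qubit state ρ can be written, after conjugation by a local unitary U_A⊗U_B, in the canonical form ρ' = (1/4)(𝟙⊗𝟙 + Σᵢ aᵢ σᵢ⊗𝟙 + Σᵢ bᵢ 𝟙⊗σᵢ + Σᵢ cᵢ σᵢ⊗σᵢ) with real vectors a, b, c; in particular, the 3×3 real correlation matrix T with entries T_{ij} = tr(ρ (σᵢ⊗σⱼ)) can be diagonalized by two rotations: there exist O₁, O₂ ∈ SO(3) such that O₁ T O₂ᵀ is diagonal. -/

import Mathlib

open Matrix Kronecker
open scoped BigOperators ComplexOrder

/-- The three Pauli matrices σ₁, σ₂, σ₃. -/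
noncomputable def pauli3 : Fin 3 → Matrix (Fin 2) (Fin 2) ℂ :=
  ![!![0, 1; 1, 0], !![0, -Complex.I; Complex.I, 0], !![1, 0; 0, -1]]

/-- The 3×3 real correlation matrix T_{ij} = tr(ρ (σᵢ⊗σⱼ)). -/
noncomputable def corrT (ρ : Matrix (Fin 2 × Fin 2) (Fin 2 × Fin 2) ℂ) :
    Matrix (Fin 3) (Fin 3) ℝ :=
  Matrix.of fun i j => ((ρ * (pauli3 i ⊗ₖ pauli3 j)).trace).re

/-- Signed singular value decomposition with special orthogonal factors. -/
lemma orth_fix (O : Matrix (Fin 3) (Fin 3) ℝ) (h : Oᵀ * O = 1) :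
    ∃ d : ℝ, (d • O)ᵀ * (d • O) = 1 ∧ (d • O).det = 1 := by
  have hd : O.det * O.det = 1 := by
    have := congrArg Matrix.det h
    simpa using this
  refine ⟨O.det, ?_, ?_⟩
  · rw [Matrix.transpose_smul, Matrix.smul_mul, Matrix.mul_smul, smul_smul, hd, h, one_smul]
  · rw [Matrix.det_smul]
    simp only [Fintype.card_fin]
    nlinarith

lemma exists_right (T : Matrix (Fin 3) (Fin 3) ℝ) :
    ∃ V : Matrix (Fin 3) (Fin 3) ℝ, Vᵀ * V = 1 ∧ ((T * V)ᵀ * (T * V)).IsDiag := by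
  have hA : (Tᵀ * T).IsHermitian := by
    simpa using Matrix.isHermitian_conjTranspose_mul_self T
  let V : Matrix (Fin 3) (Fin 3) ℝ := hA.eigenvectorUnitary
  have hV : Vᵀ * V = 1 := by
    have := Unitary.coe_star_mul_self hA.eigenvectorUnitary
    simpa [Matrix.star_eq_conjTranspose] using this
  refine ⟨V, hV, ?_⟩
  have hs : Tᵀ * T = V * diagonal (hA.eigenvalues) * Vᵀ := by
    have := hA.spectral_theorem
    simpa [Unitary.conjStarAlgAut_apply, Matrix.star_eq_conjTranspose, V, Function.comp_def] using this
  generalize hA.eigenvalues = D at hs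
  have : (T * V)ᵀ * (T * V) = diagonal D := by
    calc (T * V)ᵀ * (T * V) = Vᵀ * (Tᵀ * T) * V := by
          simp only [Matrix.transpose_mul, Matrix.mul_assoc]
      _ = (Vᵀ * V) * diagonal D * (Vᵀ * V) := by
          rw [hs]; simp only [Matrix.mul_assoc]
      _ = _ := by rw [hV]; simp
  rw [this]
  exact Matrix.isDiag_diagonal _

lemma exists_left (M : Matrix (Fin 3) (Fin 3) ℝ) (hM : (Mᵀ * M).IsDiag) :
    ∃ B : Matrix (Fin 3) (Fin 3) ℝ, Bᵀ * B = 1 ∧ (Bᵀ * M).IsDiag := by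
  let u : Fin 3 → EuclideanSpace ℝ (Fin 3) := fun j => WithLp.toLp 2 (fun i => M i j)
  have hin : ∀ x y : EuclideanSpace ℝ (Fin 3), inner ℝ x y = ∑ k, x k * y k := by
    intro x y
    simp [PiLp.inner_apply, mul_comm]
  have hu : ∀ i j, i ≠ j → inner ℝ (u i) (u j) = 0 := by
    intro i j hij
    have := hM hij
    rw [hin]
    simpa [Matrix.mul_apply, u] using this
  let v : Fin 3 → EuclideanSpace ℝ (Fin 3) := fun j => (‖u j‖⁻¹ : ℝ) • u j
  let s : Set (Fin 3) := {j | u j ≠ 0}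
  have hv : Orthonormal ℝ (s.domRestrict v) := by
    constructor
    · rintro ⟨j, hj⟩
      have : ‖u j‖ ≠ 0 := norm_ne_zero_iff.mpr hj
      simp [Set.domRestrict, v, norm_smul, this]
    · rintro ⟨i, hi⟩ ⟨j, hj⟩ hij
      have : i ≠ j := fun h => hij (by simp [h])
      simp [Set.domRestrict, v, inner_smul_left, inner_smul_right, hu i j this]
  obtain ⟨b, hb⟩ := hv.exists_orthonormalBasis_extension_of_card_eq (by simp)
  refine ⟨Matrix.of fun i j => b j i, ?_, ?_⟩
  · ext i j
    have := b.inner_eq_ite i j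
    rw [hin] at this
    simpa [Matrix.mul_apply, Matrix.one_apply] using this
  · intro i j hij
    have h1 : ((Matrix.of fun i j => b j i)ᵀ * M) i j = inner ℝ (b i) (u j) := by
      rw [hin]; simp [Matrix.mul_apply, u]
    rw [h1]
    by_cases hj : u j = 0
    · simp [hj]
    · have h2 : u j = ‖u j‖ • b j := by
        rw [hb j hj]
        have : ‖u j‖ ≠ 0 := norm_ne_zero_iff.mpr hj
        simp [v, smul_smul, this]
      rw [h2, inner_smul_right, b.inner_eq_zero hij, mul_zero]

lemma signed_svd (T : Matrix (Fin 3) (Fin 3) ℝ) :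
    ∃ (O₁ O₂ : Matrix (Fin 3) (Fin 3) ℝ),
        O₁ᵀ * O₁ = 1 ∧ O₁.det = 1 ∧ O₂ᵀ * O₂ = 1 ∧ O₂.det = 1 ∧
        (O₁ * T * O₂ᵀ).IsDiag := by
  obtain ⟨V, hV, hD⟩ := exists_right T
  obtain ⟨B, hB, hD'⟩ := exists_left _ hD
  have hB' : Bᵀᵀ * Bᵀ = 1 := by
    rw [Matrix.transpose_transpose]; exact mul_eq_one_comm.mp hB
  have hV' : Vᵀᵀ * Vᵀ = 1 := by
    rw [Matrix.transpose_transpose]; exact mul_eq_one_comm.mp hV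
  obtain ⟨d, h1, h2⟩ := orth_fix _ hB'
  obtain ⟨e, h3, h4⟩ := orth_fix _ hV'
  refine ⟨_, _, h1, h2, h3, h4, ?_⟩
  have : d • Bᵀ * T * (e • Vᵀ)ᵀ = (e * d) • (Bᵀ * (T * V)) := by
    simp [Matrix.mul_assoc, smul_smul]
  rw [this]
  exact hD'.smul _

/-- The rotated Pauli matrix attached to a real vector. -/
noncomputable def pauliVec (x : Fin 3 → ℝ) : Matrix (Fin 2) (Fin 2) ℂ :=
  ∑ k, (x k : ℂ) • pauli3 k

lemma pauliVec_eq (x : Fin 3 → ℝ) : pauliVec x =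
    !![(x 2 : ℂ), x 0 - x 1 * Complex.I; x 0 + x 1 * Complex.I, -x 2] := by
  ext i j
  fin_cases i <;> fin_cases j <;> simp [pauliVec, pauli3, Fin.sum_univ_three] <;> ring

lemma pauliVec_mul (x y : Fin 3 → ℝ) : pauliVec x * pauliVec y =
    ((x 0 * y 0 + x 1 * y 1 + x 2 * y 2 : ℝ) : ℂ) • 1 + Complex.I • pauliVec
      ![x 1 * y 2 - x 2 * y 1, x 2 * y 0 - x 0 * y 2, x 0 * y 1 - x 1 * y 0] := by
  have hI := Complex.I_mul_I
  ext i j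
  fin_cases i <;> fin_cases j <;> simp [pauliVec_eq, Matrix.mul_apply, Fin.sum_univ_two] <;>
    ring_nf <;> simp only [Complex.I_sq] <;> ring

lemma pauliVec_herm (x : Fin 3 → ℝ) : (pauliVec x)ᴴ = pauliVec x := by
  ext i j
  fin_cases i <;> fin_cases j <;> simp [pauliVec_eq] <;> ring

lemma exists_eigvec (x : Fin 3 → ℝ) (hx : x 0 * x 0 + x 1 * x 1 + x 2 * x 2 = 1) :
    ∃ v : Fin 2 → ℂ, pauliVec x *ᵥ v = v ∧ star v ⬝ᵥ v = 1 := by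
  by_cases hz : x 2 = -1
  · have h0 : x 0 = 0 := by rw [hz] at hx; nlinarith [mul_self_nonneg (x 0), mul_self_nonneg (x 1)]
    have h1 : x 1 = 0 := by rw [hz] at hx; nlinarith [mul_self_nonneg (x 0), mul_self_nonneg (x 1)]
    refine ⟨![0, 1], ?_, ?_⟩
    · ext i
      fin_cases i <;> simp [pauliVec_eq, hz, h0, h1, Matrix.mulVec, dotProduct, Fin.sum_univ_two]
    · simp [dotProduct, Fin.sum_univ_two]
  · have hp : 0 < 2 * (1 + x 2) := by
      have : -1 ≤ x 2 := by nlinarith [mul_self_nonneg (x 0), mul_self_nonneg (x 1)]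
      have := lt_of_le_of_ne this (Ne.symm hz)
      linarith
    obtain ⟨r, hr⟩ : ∃ r : ℝ, r * r * (2 * (1 + x 2)) = 1 := by
      refine ⟨(Real.sqrt (2 * (1 + x 2)))⁻¹, ?_⟩
      rw [← mul_inv, Real.mul_self_sqrt hp.le, inv_mul_cancel₀ hp.ne']
    have hxc : (x 0 : ℂ) * x 0 + x 1 * x 1 + x 2 * x 2 = 1 := by exact_mod_cast hx
    have hrc : (r : ℂ) * r * (2 * (1 + x 2)) = 1 := by exact_mod_cast hr
    have hI := Complex.I_mul_I
    refine ⟨![r * (1 + x 2), r * (x 0 + x 1 * Complex.I)], ?_, ?_⟩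
    · ext i
      fin_cases i
      · simp [pauliVec_eq, Matrix.mulVec, dotProduct, Fin.sum_univ_two]
        linear_combination (r : ℂ) * hxc - (r : ℂ) * x 1 * x 1 * hI
      · simp [pauliVec_eq, Matrix.mulVec, dotProduct, Fin.sum_univ_two]
        ring
    · simp [dotProduct, Fin.sum_univ_two]
      linear_combination hrc + (r : ℂ) * r * hxc - (r : ℂ) * r * x 1 * x 1 * hI

lemma cover (O : Matrix (Fin 3) (Fin 3) ℝ) (h : Oᵀ * O = 1) (hdet : O.det = 1) :
    ∃ U : Matrix (Fin 2) (Fin 2) ℂ, Uᴴ * U = 1 ∧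
      ∀ i, Uᴴ * pauli3 i * U = pauliVec (O i) := by
  have h' : O * Oᵀ = 1 := mul_eq_one_comm.mp h
  have hadj : O.adjugate = Oᵀ := by
    calc O.adjugate = O.adjugate * (O * Oᵀ) := by rw [h', mul_one]
      _ = Oᵀ := by rw [← Matrix.mul_assoc, Matrix.adjugate_mul, hdet]; simp
  have hdot : ∀ i j, O i 0 * O j 0 + O i 1 * O j 1 + O i 2 * O j 2 =
      if i = j then 1 else 0 := by
    intro i j
    have := congrFun (congrFun h' i) j
    simpa [Matrix.mul_apply, Fin.sum_univ_three, Matrix.one_apply] using this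
  have hc : ![O 2 1 * O 0 2 - O 2 2 * O 0 1, O 2 2 * O 0 0 - O 2 0 * O 0 2,
      O 2 0 * O 0 1 - O 2 1 * O 0 0] = O 1 := by
    rw [Matrix.adjugate_fin_three] at hadj
    have e0 := congrFun (congrFun hadj 0) 1
    have e1 := congrFun (congrFun hadj 1) 1
    have e2 := congrFun (congrFun hadj 2) 1
    simp at e0 e1 e2
    ext k
    fin_cases k <;> simp <;> linarith
  have hc' : ![O 0 1 * O 2 2 - O 0 2 * O 2 1, O 0 2 * O 2 0 - O 0 0 * O 2 2,
      O 0 0 * O 2 1 - O 0 1 * O 2 0] = -O 1 := by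
    rw [← hc]
    ext k
    fin_cases k <;> simp <;> ring
  have hneg : pauliVec (-O 1) = -pauliVec (O 1) := by
    simp [pauliVec, Finset.sum_neg_distrib]
  have hself : ∀ x : Fin 3 → ℝ, pauliVec x * pauliVec x =
      ((x 0 * x 0 + x 1 * x 1 + x 2 * x 2 : ℝ) : ℂ) • 1 := by
    intro x
    rw [pauliVec_mul]
    have : ![x 1 * x 2 - x 2 * x 1, x 2 * x 0 - x 0 * x 2, x 0 * x 1 - x 1 * x 0] = 0 := by
      ext k
      fin_cases k <;> simp <;> ring
    rw [this]
    simp [pauliVec]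
  have h11 : pauliVec (O 0) * pauliVec (O 0) = 1 := by
    rw [hself, hdot]; simp
  have h31 : pauliVec (O 2) * pauliVec (O 0) = Complex.I • pauliVec (O 1) := by
    rw [pauliVec_mul, hc, hdot]; simp
  have h13 : pauliVec (O 0) * pauliVec (O 2) = -(Complex.I • pauliVec (O 1)) := by
    rw [pauliVec_mul, hc', hdot, hneg]; simp
  have h2 : pauliVec (O 1) = -Complex.I • (pauliVec (O 2) * pauliVec (O 0)) := by
    rw [h31, smul_smul]; simp
  obtain ⟨v, hv, hvn⟩ := exists_eigvec (O 2) (by rw [hdot]; simp)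
  obtain ⟨w, hw⟩ : ∃ w, w = pauliVec (O 0) *ᵥ v := ⟨_, rfl⟩
  have t1v : pauliVec (O 0) *ᵥ v = w := hw.symm
  have t1w : pauliVec (O 0) *ᵥ w = v := by
    rw [hw, Matrix.mulVec_mulVec, h11, Matrix.one_mulVec]
  have t3w : pauliVec (O 2) *ᵥ w = -w := by
    rw [hw, Matrix.mulVec_mulVec, h31, ← neg_neg (Complex.I • pauliVec (O 1)), ← h13,
      Matrix.neg_mulVec, ← Matrix.mulVec_mulVec, hv]
  have t2v : pauliVec (O 1) *ᵥ v = Complex.I • w := by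
    rw [h2, Matrix.smul_mulVec, ← Matrix.mulVec_mulVec, t1v, t3w]; simp
  have t2w : pauliVec (O 1) *ᵥ w = -Complex.I • v := by
    rw [h2, Matrix.smul_mulVec, ← Matrix.mulVec_mulVec, t1w, hv]
  have adj : ∀ (x : Fin 3 → ℝ) (p q : Fin 2 → ℂ),
      star (pauliVec x *ᵥ p) ⬝ᵥ q = star p ⬝ᵥ (pauliVec x *ᵥ q) := by
    intro x p q
    rw [Matrix.star_mulVec, pauliVec_herm, Matrix.dotProduct_mulVec]
  have hww : star w ⬝ᵥ w = 1 := by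
    nth_rewrite 1 [hw]
    rw [adj, t1w, hvn]
  have hvw : star v ⬝ᵥ w = 0 := by
    have : star v ⬝ᵥ w = -(star v ⬝ᵥ w) := by
      nth_rewrite 1 [← hv]
      rw [adj, t3w, dotProduct_neg]
    exact self_eq_neg.mp this
  have hwv : star w ⬝ᵥ v = 0 := by
    rw [hw, adj, t1v, hvw]
  let W : Matrix (Fin 2) (Fin 2) ℂ := !![v 0, w 0; v 1, w 1]
  have hW : Wᴴ * W = 1 := by
    simp only [dotProduct, Fin.sum_univ_two, Pi.star_apply] at hvn hww hvw hwv
    ext i j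
    fin_cases i <;> fin_cases j <;>
      simp [W, Matrix.mul_apply, Fin.sum_univ_two] <;> assumption
  have hW' : W * Wᴴ = 1 := mul_eq_one_comm.mp hW
  have key : ∀ i, W * pauli3 i = pauliVec (O i) * W := by
    intro i
    have ent : ∀ (A : Matrix (Fin 2) (Fin 2) ℂ) (p q : Fin 2 → ℂ), A *ᵥ p = q →
        ∀ k, A k 0 * p 0 + A k 1 * p 1 = q k := by
      intro A p q hpq k
      rw [← hpq]; simp [Matrix.mulVec, dotProduct, Fin.sum_univ_two]
    have a1 := ent _ _ _ t1v
    have a2 := ent _ _ _ t1w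
    have a3 := ent _ _ _ t2v
    have a4 := ent _ _ _ t2w
    have a5 := ent _ _ _ hv
    have a6 := ent _ _ _ t3w
    ext k l
    rw [Matrix.mul_apply, Matrix.mul_apply, Fin.sum_univ_two, Fin.sum_univ_two]
    fin_cases i <;> fin_cases l <;> fin_cases k <;> simp [W, a1, a2, a3, a4, a5, a6, pauli3] <;> ring
  refine ⟨Wᴴ, by simpa using hW', fun i => ?_⟩
  rw [Matrix.conjTranspose_conjTranspose, key, Matrix.mul_assoc, hW', mul_one]

set_option maxHeartbeats 4000000 in
lemma canonical_of_diag (M : Matrix (Fin 2 × Fin 2) (Fin 2 × Fin 2) ℂ)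
    (hM : M.IsHermitian) (htr : M.trace = 1) (hd : (corrT M).IsDiag) :
    ∃ a b c : Fin 3 → ℝ,
        M = ((1 : ℂ) / 4) • ((1 : Matrix (Fin 2 × Fin 2) (Fin 2 × Fin 2) ℂ)
            + ∑ i, (a i : ℂ) • (pauli3 i ⊗ₖ (1 : Matrix (Fin 2) (Fin 2) ℂ))
            + ∑ i, (b i : ℂ) • ((1 : Matrix (Fin 2) (Fin 2) ℂ) ⊗ₖ pauli3 i)
            + ∑ i, (c i : ℂ) • (pauli3 i ⊗ₖ pauli3 i)) := by
  refine ⟨fun i => ((M * (pauli3 i ⊗ₖ (1 : Matrix (Fin 2) (Fin 2) ℂ))).trace).re,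
    fun i => ((M * ((1 : Matrix (Fin 2) (Fin 2) ℂ) ⊗ₖ pauli3 i)).trace).re,
    fun i => corrT M i i, ?_⟩
  have d01 := hd (show (0 : Fin 3) ≠ 1 by decide)
  have d02 := hd (show (0 : Fin 3) ≠ 2 by decide)
  have d10 := hd (show (1 : Fin 3) ≠ 0 by decide)
  have d12 := hd (show (1 : Fin 3) ≠ 2 by decide)
  have d20 := hd (show (2 : Fin 3) ≠ 0 by decide)
  have d21 := hd (show (2 : Fin 3) ≠ 1 by decide)
  have hr : ∀ i j, (M i j).re = (M j i).re := fun i j => by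
    rw [← hM.apply i j]; simp
  have hi : ∀ i j, (M i j).im = -(M j i).im := fun i j => by
    rw [← hM.apply i j]; simp
  have htr1 := congrArg Complex.re htr
  have htr2 := congrArg Complex.im htr
  have i0 := hi (0, 0) (0, 0)
  have i1 := hi (0, 1) (0, 1)
  have i2 := hi (1, 0) (1, 0)
  have i3 := hi (1, 1) (1, 1)
  have r01 := hr (0, 0) (0, 1)
  have r02 := hr (0, 0) (1, 0)
  have r03 := hr (0, 0) (1, 1)
  have r12 := hr (0, 1) (1, 0)
  have r13 := hr (0, 1) (1, 1)
  have r23 := hr (1, 0) (1, 1)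
  have i01 := hi (0, 0) (0, 1)
  have i02 := hi (0, 0) (1, 0)
  have i03 := hi (0, 0) (1, 1)
  have i12 := hi (0, 1) (1, 0)
  have i13 := hi (0, 1) (1, 1)
  have i23 := hi (1, 0) (1, 1)
  clear hr hi hd hM htr
  simp [corrT, pauli3, Matrix.trace, Matrix.mul_apply, Fintype.sum_prod_type, Fin.sum_univ_two,
    Matrix.kroneckerMap_apply] at d01 d02 d10 d12 d20 d21 htr1 htr2
  ext ⟨i, j⟩ ⟨k, l⟩
  fin_cases i <;> fin_cases j <;> fin_cases k <;> fin_cases l <;> apply Complex.ext <;>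
    simp [corrT, pauli3, Matrix.trace, Matrix.mul_apply, Fintype.sum_prod_type, Fin.sum_univ_two,
      Fin.sum_univ_three, Matrix.kroneckerMap_apply, Matrix.one_apply] <;> linarith

lemma corrT_conj (ρ : Matrix (Fin 2 × Fin 2) (Fin 2 × Fin 2) ℂ)
    (UA UB : Matrix (Fin 2) (Fin 2) ℂ) (O₁ O₂ : Matrix (Fin 3) (Fin 3) ℝ)
    (hA : ∀ i, UAᴴ * pauli3 i * UA = pauliVec (O₁ i))
    (hB : ∀ i, UBᴴ * pauli3 i * UB = pauliVec (O₂ i)) :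
    corrT ((UA ⊗ₖ UB) * ρ * (UA ⊗ₖ UB)ᴴ) = O₁ * corrT ρ * O₂ᵀ := by
  ext i j
  have h1 : ((UA ⊗ₖ UB) * ρ * (UA ⊗ₖ UB)ᴴ * (pauli3 i ⊗ₖ pauli3 j)).trace
      = (ρ * (pauliVec (O₁ i) ⊗ₖ pauliVec (O₂ j))).trace := by
    rw [← hA, ← hB, Matrix.mul_kronecker_mul, Matrix.mul_kronecker_mul,
      ← Matrix.conjTranspose_kronecker, Matrix.mul_assoc, Matrix.mul_assoc, Matrix.trace_mul_comm]
    simp only [Matrix.mul_assoc]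
  have h2 : ρ * (pauliVec (O₁ i) ⊗ₖ pauliVec (O₂ j)) =
      ∑ k, ∑ l, ((O₁ i k * O₂ j l : ℝ) : ℂ) • (ρ * (pauli3 k ⊗ₖ pauli3 l)) := by
    simp only [pauliVec, Fin.sum_univ_three, Matrix.add_kronecker, Matrix.kronecker_add,
      Matrix.smul_kronecker, Matrix.kronecker_smul, Matrix.mul_add, Matrix.mul_smul, smul_smul,
      smul_add, Complex.ofReal_mul]
    module
  simp only [corrT, Matrix.of_apply]
  rw [h1, h2]
  simp only [Matrix.trace_add, Matrix.trace_smul, Complex.add_re, smul_eq_mul,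
    Complex.re_ofReal_mul, Matrix.mul_apply, Matrix.of_apply, Matrix.transpose_apply,
    Fin.sum_univ_three]
  ring

/-- every two-qubit state can be brought by a local unitary U_A ⊗ U_B to the
canonical form (1/4)(𝟙⊗𝟙 + Σᵢ aᵢ σᵢ⊗𝟙 + Σᵢ bᵢ 𝟙⊗σᵢ + Σᵢ cᵢ σᵢ⊗σᵢ); in particular its
correlation matrix T is diagonalized by two special orthogonal matrices. -/
theorem two_qubit_canonical_form
    (ρ : Matrix (Fin 2 × Fin 2) (Fin 2 × Fin 2) ℂ)
    (hρ : ρ.PosSemidef ∧ ρ.trace = 1) :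
    (∃ (UA UB : Matrix (Fin 2) (Fin 2) ℂ),
      UAᴴ * UA = 1 ∧ UBᴴ * UB = 1 ∧
      ∃ a b c : Fin 3 → ℝ,
        (UA ⊗ₖ UB) * ρ * (UA ⊗ₖ UB)ᴴ
          = ((1 : ℂ) / 4) • ((1 : Matrix (Fin 2 × Fin 2) (Fin 2 × Fin 2) ℂ)
            + ∑ i, (a i : ℂ) • (pauli3 i ⊗ₖ (1 : Matrix (Fin 2) (Fin 2) ℂ))
            + ∑ i, (b i : ℂ) • ((1 : Matrix (Fin 2) (Fin 2) ℂ) ⊗ₖ pauli3 i)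
            + ∑ i, (c i : ℂ) • (pauli3 i ⊗ₖ pauli3 i)))
    ∧ (∃ (O₁ O₂ : Matrix (Fin 3) (Fin 3) ℝ),
        O₁ᵀ * O₁ = 1 ∧ O₁.det = 1 ∧ O₂ᵀ * O₂ = 1 ∧ O₂.det = 1 ∧
        (O₁ * corrT ρ * O₂ᵀ).IsDiag) := by
  obtain ⟨O₁, O₂, h1, d1, h2, d2, hD⟩ := signed_svd (corrT ρ)
  refine ⟨?_, O₁, O₂, h1, d1, h2, d2, hD⟩
  obtain ⟨UA, hUA, hA⟩ := cover O₁ h1 d1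
  obtain ⟨UB, hUB, hB⟩ := cover O₂ h2 d2
  refine ⟨UA, UB, hUA, hUB, canonical_of_diag _ ?_ ?_ ?_⟩
  · exact Matrix.isHermitian_mul_mul_conjTranspose _ hρ.1.isHermitian
  · rw [Matrix.mul_assoc, Matrix.trace_mul_comm, Matrix.mul_assoc,
      Matrix.conjTranspose_kronecker, ← Matrix.mul_kronecker_mul, hUA, hUB,
      Matrix.one_kronecker_one, mul_one, hρ.2]
  · rw [corrT_conj ρ UA UB O₁ O₂ hA hB]
    exact hD
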